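/- Let (a_n)_{n∈ℕ} be positive real numbers for which there exist C > 0 and k ∈ ℕ with a_n ≥ C (1+n)^{−k} for all n. Then for every ε ∈ (0, π/2) there exists c : ℕ → ℂ, not identically zero, with Σ_n |c_n| < ∞ and Σ_n |c_n|²/a_n < ∞, such that the function F(t) = Σ_{n∈ℕ} (c_n e^{2int} − conj(c_n) e^{−2int}) vanishes for every t ∈ (−π/2 + ε, π/2 − ε). -/

import Mathlib

open FourierTransform in
/-- A Fourier transform of a purely imaginary function is anti-Hermitian. -/
theorem Real.fourier_neg_of_conj_eq_neg {f : ℝ → ℂ} (hf : ∀ x, starRingEnd ℂ (f x) = -f x)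
    (w : ℝ) : 𝓕 f (-w) = -starRingEnd ℂ (𝓕 f w) := by
  simp only [Real.fourier_real_eq_integral_exp_smul]
  rw [← integral_conj, ← MeasureTheory.integral_neg]
  congr 1 with v
  simp only [smul_eq_mul, map_mul, hf, ← Complex.exp_conj, Complex.conj_ofReal, Complex.conj_I]
  rw [mul_neg _ (f v), neg_neg]
  congr 2
  push_cast
  ring

/-- A Schwartz function decays along the natural numbers faster than any polynomial. -/
theorem SchwartzMap.exists_norm_natCast_le (g : SchwartzMap ℝ ℂ) (p : ℕ) :
    ∃ K : ℝ, 0 ≤ K ∧ ∀ n : ℕ, ‖g n‖ ≤ K / (1 + (n : ℝ)) ^ p := by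
  have h (x : ℝ) := SchwartzMap.one_add_le_sup_seminorm_apply (𝕜 := ℝ) (m := (p, 0))
    (le_refl p) (le_refl 0) g x
  refine ⟨_, le_trans (by positivity) (h 0), fun n ↦ ?_⟩
  rw [le_div_iff₀ (by positivity), mul_comm]
  simpa using h n

theorem summable_div_one_add_natCast_sq (K : ℝ) :
    Summable fun n : ℕ ↦ K / (1 + (n : ℝ)) ^ 2 := by
  have h := ((summable_nat_add_iff 1).2
    (Real.summable_one_div_nat_pow.2 one_lt_two)).mul_left K
  refine h.congr fun n ↦ ?_
  push_cast
  ring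

/-- A sequence of rapid decay is absolutely summable, and square summable against the inverse of
any weight decaying at most polynomially. -/
theorem summable_norm_and_sq_div_of_decay {c : ℕ → ℂ} {a : ℕ → ℝ} {C K : ℝ} {k : ℕ} (hC : 0 < C)
    (hlow : ∀ n : ℕ, C / (1 + (n : ℝ)) ^ k ≤ a n)
    (hc : ∀ n : ℕ, ‖c n‖ ≤ K / (1 + (n : ℝ)) ^ (k + 2)) :
    Summable (fun n ↦ ‖c n‖) ∧ Summable (fun n ↦ ‖c n‖ ^ 2 / a n) := by
  have hK : 0 ≤ K := by simpa using (norm_nonneg _).trans (hc 0)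
  have hone (n : ℕ) : 1 ≤ 1 + (n : ℝ) := by simp
  have ha (n : ℕ) : 0 < a n := lt_of_lt_of_le (by positivity) (hlow n)
  constructor
  · refine Summable.of_nonneg_of_le (fun _ ↦ norm_nonneg _) (fun n ↦ (hc n).trans ?_)
      (summable_div_one_add_natCast_sq K)
    gcongr
    · exact hone n
    · lia
  · refine Summable.of_nonneg_of_le (fun n ↦ div_nonneg (sq_nonneg _) (ha n).le) (fun n ↦ ?_)
      (summable_div_one_add_natCast_sq (K ^ 2 / C))
    calc ‖c n‖ ^ 2 / a n
        ≤ (K / (1 + (n : ℝ)) ^ (k + 2)) ^ 2 / (C / (1 + (n : ℝ)) ^ k) := by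
          gcongr
          · exact hc n
          · exact hlow n
      _ = K ^ 2 / C / (1 + (n : ℝ)) ^ (k + 4) := by
          field_simp
          ring
      _ ≤ K ^ 2 / C / (1 + (n : ℝ)) ^ 2 := by
          gcongr
          · exact hone n
          · lia

/-- The coefficients of frequency `2 n`, `n ≥ 0`, of the Fourier series with coefficients `g n`,
`n : ℤ`; the constant term is halved because it is counted twice by
`∑ (c_n e^{2int} - conj c_n e^{-2int})`. -/
noncomputable def halvedCoeff (g : SchwartzMap ℝ ℂ) (n : ℕ) : ℂ :=
  if n = 0 then g 0 / 2 else g n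

theorem norm_halvedCoeff_le (g : SchwartzMap ℝ ℂ) (n : ℕ) : ‖halvedCoeff g n‖ ≤ ‖g n‖ := by
  unfold halvedCoeff
  split_ifs with h
  · simp [h]
  · rfl

open FourierTransform in
/-- If a purely imaginary Schwartz function vanishes on `t / π + ℤ`, then the Fourier series of its
periodization vanishes at `t`. -/
theorem tsum_halvedCoeff_fourier_eq_zero {f : SchwartzMap ℝ ℂ}
    (hf : ∀ x, starRingEnd ℂ (f x) = -f x) {t : ℝ} (ht : ∀ m : ℤ, f (t / Real.pi + m) = 0) :
    ∑' n : ℕ, (halvedCoeff (𝓕 f) n * Complex.exp (Complex.I * (2 * (n : ℂ) * (t : ℂ))) -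
      (starRingEnd ℂ) (halvedCoeff (𝓕 f) n) *
        Complex.exp (-(Complex.I * (2 * (n : ℂ) * (t : ℂ))))) = 0 := by
  have hconj (w : ℝ) : 𝓕 f (-w) = -starRingEnd ℂ (𝓕 f w) := by
    simpa only [SchwartzMap.fourier_coe] using Real.fourier_neg_of_conj_eq_neg hf w
  have hchar (m : ℤ) : fourier m ((t / Real.pi : ℝ) : UnitAddCircle) =
      Complex.exp (Complex.I * (2 * (m : ℂ) * (t : ℂ))) := by
    rw [fourier_coe_apply]
    have : (Real.pi : ℂ) ≠ 0 := by exact_mod_cast Real.pi_ne_zero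
    congr 1
    push_cast
    field_simp
  set G : ℤ → ℂ := fun m ↦ 𝓕 f (m : ℝ) * Complex.exp (Complex.I * (2 * (m : ℂ) * (t : ℂ)))
    with hG
  have hGsum : Summable G := by
    refine Summable.of_norm ?_
    have hnorm (m : ℤ) : ‖G m‖ = ‖𝓕 f (m : ℝ)‖ := by
      rw [hG, norm_mul, Complex.norm_exp]
      simp
    simp only [hnorm]
    have hO := ((𝓕 f).isBigO_cocompact_rpow (-2)).comp_tendsto Int.tendsto_coe_cofinite
    exact (summable_of_isBigO (Real.summable_abs_int_rpow one_lt_two) hO).norm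
  have hGzero : ∑' m, G m = 0 := by
    have h := SchwartzMap.tsum_eq_tsum_fourier f (t / Real.pi)
    simp only [ht, tsum_zero, hchar] at h
    exact h.symm
  have hnat := (hGzero ▸ hGsum.hasSum).nat_add_neg.sub (hasSum_ite_eq 0 (G 0))
  rw [zero_add, sub_self] at hnat
  refine Eq.trans (tsum_congr fun n ↦ ?_) hnat.tsum_eq
  rcases eq_or_ne n 0 with rfl | hn
  · have h0 := hconj 0
    rw [neg_zero] at h0
    simp only [halvedCoeff, hG, if_true, map_div₀, Complex.conj_ofNat, ← neg_eq_iff_eq_neg.2 h0]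
    simp
    ring
  · have := hconj n
    simp only [halvedCoeff, hG, if_neg hn]
    push_cast
    rw [this]
    ring_nf

open FourierTransform in

/-- For positive coefficients `a_n` decaying at most polynomially, and every
`ε ∈ (0, π/2)`, there is a not-identically-zero sequence `c : ℕ → ℂ` with `Σ |c_n| < ∞`
and `Σ |c_n|²/a_n < ∞` such that
`F(t) = Σ_n (c_n e^{2int} − conj(c_n) e^{−2int})` vanishes on `(−π/2 + ε, π/2 − ε)`. -/
theorem evenly_spaced_spectral_density_lower_bound
    (a : ℕ → ℝ) (hapos : ∀ n : ℕ, 0 < a n)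
    (C : ℝ) (hC : 0 < C) (k : ℕ)
    (hlow : ∀ n : ℕ, C / (1 + (n : ℝ)) ^ k ≤ a n)
    (ε : ℝ) (hε : ε ∈ Set.Ioo 0 (Real.pi / 2)) :
    ∃ c : ℕ → ℂ, c ≠ 0 ∧ Summable (fun n : ℕ => ‖c n‖) ∧
      Summable (fun n : ℕ => ‖c n‖ ^ 2 / a n) ∧
      ∀ t ∈ Set.Ioo (-(Real.pi / 2) + ε) (Real.pi / 2 - ε),
        ∑' n : ℕ, (c n * Complex.exp (Complex.I * (2 * (n : ℂ) * (t : ℂ))) -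
          (starRingEnd ℂ) (c n) * Complex.exp (-(Complex.I * (2 * (n : ℂ) * (t : ℂ))))) = 0 := by
  obtain ⟨hε0, hεlt⟩ := hε
  have hpi := Real.pi_pos
  have hδ : 0 < ε / Real.pi := by positivity
  let b : ContDiffBump (1 / 2 : ℝ) := ⟨ε / Real.pi / 2, ε / Real.pi, by positivity, by linarith⟩
  have hsupp : HasCompactSupport fun x ↦ Complex.I * (b x : ℂ) :=
    (b.hasCompactSupport.comp_left Complex.ofReal_zero).mul_left
  have hsmooth : ContDiff ℝ (⊤ : ℕ∞) fun x ↦ Complex.I * (b x : ℂ) :=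
    contDiff_const.mul (Complex.ofRealCLM.contDiff.comp b.contDiff)
  set f := hsupp.toSchwartzMap hsmooth
  have hf (x : ℝ) : f x = Complex.I * (b x : ℂ) := rfl
  obtain ⟨K, -, hK⟩ := SchwartzMap.exists_norm_natCast_le (𝓕 f) (k + 2)
  obtain ⟨hsum, hsq⟩ := summable_norm_and_sq_div_of_decay hC hlow
    fun n ↦ (norm_halvedCoeff_le (𝓕 f) n).trans (hK n)
  refine ⟨halvedCoeff (𝓕 f), fun h ↦ ?_, hsum, hsq, fun t ht ↦
    tsum_halvedCoeff_fourier_eq_zero (fun x ↦ by simp [hf]) fun m ↦ ?_⟩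
  · have h0 : (𝓕 f) 0 = Complex.I * ((∫ x, b x : ℝ) : ℂ) := by
      rw [SchwartzMap.fourier_coe, Real.fourier_real_eq_integral_exp_smul]
      simp [hf, MeasureTheory.integral_const_mul, integral_complex_ofReal]
    have h1 : (𝓕 f) 0 = 0 := by simpa [halvedCoeff] using congrFun h 0
    rw [h0] at h1
    have : (∫ x, b x) = 0 := by simpa using h1
    exact b.integral_pos.ne' this
  · have hdist : b.rOut ≤ dist (t / Real.pi + m) (1 / 2 : ℝ) := by
      change ε / Real.pi ≤ _
      have hlo : -(1 / 2) + ε / Real.pi < t / Real.pi := by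
        rw [lt_div_iff₀ hpi]; field_simp; linarith [ht.1]
      have hhi : t / Real.pi < 1 / 2 - ε / Real.pi := by
        rw [div_lt_iff₀ hpi]; field_simp; linarith [ht.2]
      rw [Real.dist_eq]
      rcases le_or_gt m 0 with hm | hm
      · have : (m : ℝ) ≤ 0 := by exact_mod_cast hm
        exact le_trans (by linarith) (neg_le_abs _)
      · have : (1 : ℝ) ≤ m := by exact_mod_cast hm
        exact le_trans (by linarith) (le_abs_self _)
    rw [hf, b.zero_of_le_dist hdist, Complex.ofReal_zero, mul_zero]
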